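/- arXiv:math/0512446 — 3 statements merged into one kernel-verified Lean document; each statement's English description precedes it below -/
import Mathlib

section
/- Let $G$ be a polycyclic-by-finite group which is not polycyclic. Then there exists a nonzero projective right $\mathbb{Z}G$-module $P$ such that $P$ has no nonzero finitely generated direct summands; in particular, $P$ is not free. -/
open TensorProduct

/-- A group is polycyclic if it has a subnormal series with cyclic factors. -/
def IsPolycyclic (G : Type*) [Group G] : Prop :=
  ∃ (n : ℕ) (s : Fin (n + 1) → Subgroup G),
    s 0 = ⊥ ∧ s (Fin.last n) = ⊤ ∧
    ∀ i : Fin n, s i.castSucc ≤ s i.succ ∧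
      ∃ _ : ((s i.castSucc).subgroupOf (s i.succ)).Normal,
        IsCyclic ((s i.succ) ⧸ (s i.castSucc).subgroupOf (s i.succ))

/-- A group is polycyclic-by-finite if it has a normal polycyclic subgroup of
finite index. -/
def IsPolycyclicByFinite (G : Type*) [Group G] : Prop :=
  ∃ N : Subgroup G, N.Normal ∧ N.FiniteIndex ∧ IsPolycyclic N

universe u

theorem IsPolycyclic.induction {P : ∀ (G : Type u) [Group G], Prop}
    (equiv : ∀ (G H : Type u) [Group G] [Group H], G ≃* H → P G → P H)
    (trivial : ∀ (G : Type u) [Group G], Subsingleton G → P G)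
    (extension : ∀ (G : Type u) [Group G] (K : Subgroup G) [K.Normal],
      IsCyclic (G ⧸ K) → P K → P G)
    {G : Type u} [Group G] (hG : IsPolycyclic G) : P G := by
  obtain ⟨n, s, h0, hn, hs⟩ := hG
  have key : ∀ i : Fin (n + 1), P (s i) := by
    intro i
    induction i using Fin.induction with
    | zero =>
      rw [h0]
      exact trivial _ inferInstance
    | succ i ih =>
      obtain ⟨hle, hN, hc⟩ := hs i
      exact extension _ _ hc (equiv _ _ (Subgroup.subgroupOfEquivOfLe hle).symm ih)
  have := key (Fin.last n)
  rw [hn] at this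
  exact equiv _ _ Subgroup.topEquiv this

theorem IsPolycyclic.of_subsingleton (G : Type u) [Group G] [Subsingleton G] :
    IsPolycyclic G :=
  ⟨0, fun _ ↦ ⊥, rfl, Subsingleton.elim _ _, fun i ↦ i.elim0⟩

/-- `A` is a normal subgroup of `B` with cyclic quotient. -/
def Subgroup.IsCyclicStep {G : Type*} [Group G] (A B : Subgroup G) : Prop :=
  A ≤ B ∧ ∃ _ : (A.subgroupOf B).Normal, IsCyclic (B ⧸ A.subgroupOf B)

theorem Subgroup.isCyclicStep_top {G : Type*} [Group G] (K : Subgroup G) [K.Normal]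
    (hc : IsCyclic (G ⧸ K)) : K.IsCyclicStep ⊤ := by
  refine ⟨le_top, inferInstance, ?_⟩
  let f : G ⧸ K →* (⊤ : Subgroup G) ⧸ K.subgroupOf ⊤ :=
    QuotientGroup.map K (K.subgroupOf ⊤) (Subgroup.topEquiv (G := G)).symm.toMonoidHom
      fun x hx ↦ hx
  refine isCyclic_of_surjective f fun x ↦ ?_
  obtain ⟨y, rfl⟩ := QuotientGroup.mk_surjective x
  exact ⟨QuotientGroup.mk y.1, rfl⟩

theorem Subgroup.IsCyclicStep.map {G H : Type*} [Group G] [Group H] {A B : Subgroup G}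
    (h : A.IsCyclicStep B) (φ : G →* H) (hφ : Function.Injective φ) :
    (A.map φ).IsCyclicStep (B.map φ) := by
  obtain ⟨hle, hN, hc⟩ := h
  let e : B ≃* B.map φ := B.equivMapOfInjective φ hφ
  have hmap : (A.map φ).subgroupOf (B.map φ) = (A.subgroupOf B).map e.toMonoidHom := by
    ext x
    obtain ⟨y, rfl⟩ := e.surjective x
    constructor
    · rintro ⟨z, hz, hzy⟩
      refine ⟨y, ?_, rfl⟩
      have : z = y.1 := hφ hzy
      rw [this] at hz
      exact hz
    · rintro ⟨z, hz, hzy⟩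
      have : z = y := e.injective hzy
      subst this
      exact ⟨z.1, hz, rfl⟩
  have hN' : ((A.map φ).subgroupOf (B.map φ)).Normal := by
    rw [hmap]
    exact hN.map _ e.surjective
  refine ⟨Subgroup.map_mono hle, hN', ?_⟩
  let f := QuotientGroup.map (A.subgroupOf B) ((A.map φ).subgroupOf (B.map φ)) e.toMonoidHom
    (by rw [hmap]; exact Subgroup.le_comap_map _ _)
  refine isCyclic_of_surjective f fun x ↦ ?_
  obtain ⟨y, rfl⟩ := QuotientGroup.mk_surjective x
  obtain ⟨z, rfl⟩ := e.surjective y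
  exact ⟨QuotientGroup.mk z, rfl⟩

theorem IsPolycyclic.of_isCyclic_quotient {G : Type u} [Group G] (K : Subgroup G) [K.Normal]
    (hc : IsCyclic (G ⧸ K)) (hK : IsPolycyclic K) : IsPolycyclic G := by
  obtain ⟨n, s, h0, hn, hs⟩ := hK
  refine ⟨n + 1, Fin.snoc (α := fun _ ↦ Subgroup G) (fun i ↦ (s i).map K.subtype) ⊤, ?_,
    by simp, ?_⟩
  · rw [← Fin.castSucc_zero, Fin.snoc_castSucc, h0, Subgroup.map_bot]
  intro i
  change Subgroup.IsCyclicStep _ _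
  induction i using Fin.lastCases with
  | last =>
    have hK' : (s (Fin.last n)).map K.subtype = K := by
      rw [hn, ← MonoidHom.range_eq_map, Subgroup.range_subtype]
    rw [Fin.snoc_castSucc, Fin.succ_last, Fin.snoc_last, hK']
    exact K.isCyclicStep_top hc
  | cast i =>
    rw [Fin.succ_castSucc, Fin.snoc_castSucc, Fin.snoc_castSucc]
    exact Subgroup.IsCyclicStep.map (hs i) _ K.subtype_injective

theorem Subgroup.wellFoundedGT_of_extension {G : Type*} [Group G] (K : Subgroup G) [K.Normal]
    (hK : WellFoundedGT (Subgroup K)) (hQ : WellFoundedGT (Subgroup (G ⧸ K))) :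
    WellFoundedGT (Subgroup G) := by
  have hmono : StrictMono fun H : Subgroup G ↦
      ((H.subgroupOf K, H.map (QuotientGroup.mk' K)) : Subgroup K × Subgroup (G ⧸ K)) := by
    refine fun H H' hlt ↦ lt_of_le_of_ne
      ⟨Subgroup.comap_mono hlt.le, Subgroup.map_mono hlt.le⟩ fun he ↦ hlt.not_ge fun x hx ↦ ?_
    obtain ⟨h₁, h₂⟩ := Prod.ext_iff.mp he
    simp only at h₁ h₂
    have hx' : QuotientGroup.mk' K x ∈ H.map (QuotientGroup.mk' K) :=
      h₂ ▸ Subgroup.mem_map_of_mem _ hx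
    obtain ⟨y, hy, hyx⟩ := hx'
    have hyK : y⁻¹ * x ∈ K := QuotientGroup.eq.mp hyx
    have : (⟨y⁻¹ * x, hyK⟩ : K) ∈ H.subgroupOf K := by
      rw [h₁]
      exact H'.mul_mem (H'.inv_mem (hlt.le hy)) hx
    simpa using H.mul_mem hy (Subgroup.mem_subgroupOf.mp this)
  exact hmono.wellFoundedGT

theorem Subgroup.wellFoundedGT_of_surjective {G H : Type*} [Group G] [Group H] (f : G →* H)
    (hf : Function.Surjective f) (hG : WellFoundedGT (Subgroup G)) :
    WellFoundedGT (Subgroup H) := by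
  have hmono : StrictMono (Subgroup.comap f) :=
    (Subgroup.gc_map_comap f).monotone_u.strictMono_of_injective (Subgroup.comap_injective hf)
  exact hmono.wellFoundedGT

theorem Subgroup.wellFoundedGT_of_isCyclic (G : Type*) [Group G] [IsCyclic G] :
    WellFoundedGT (Subgroup G) := by
  obtain ⟨g, hg⟩ := IsCyclic.exists_generator (α := G)
  have hZ : WellFoundedGT (Subgroup (Multiplicative ℤ)) := by
    have h : WellFoundedGT (Submodule ℤ ℤ) := inferInstance
    have hmono : StrictMono fun H : Subgroup (Multiplicative ℤ) ↦
        AddSubgroup.toIntSubmodule (Subgroup.toAddSubgroup' H) := fun H H' hlt ↦ hlt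
    exact hmono.wellFoundedGT
  exact Subgroup.wellFoundedGT_of_surjective (zpowersHom G g) (fun x ↦ hg x) hZ

theorem IsPolycyclic.wellFoundedGT {G : Type u} [Group G] (hG : IsPolycyclic G) :
    WellFoundedGT (Subgroup G) := by
  refine IsPolycyclic.induction (P := fun G _ ↦ WellFoundedGT (Subgroup G)) ?_ ?_ ?_ hG
  · intro G H _ _ e h
    exact Subgroup.wellFoundedGT_of_surjective e.toMonoidHom e.surjective h
  · intro G _ h
    infer_instance
  · intro G _ K _ hc hK
    exact Subgroup.wellFoundedGT_of_extension K hK (Subgroup.wellFoundedGT_of_isCyclic _)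

theorem IsPolycyclicByFinite.wellFoundedGT {G : Type u} [Group G] (hG : IsPolycyclicByFinite G) :
    WellFoundedGT (Subgroup G) := by
  obtain ⟨N, hN, hfin, hp⟩ := hG
  exact Subgroup.wellFoundedGT_of_extension N hp.wellFoundedGT inferInstance

theorem IsPolycyclic.isSolvable {G : Type u} [Group G] (hG : IsPolycyclic G) :
    Group.IsSolvable G := by
  refine IsPolycyclic.induction (P := fun G _ ↦ Group.IsSolvable G) ?_ ?_ ?_ hG
  · intro G H _ _ e h
    exact Group.isSolvable_of_surjective (f := e.toMonoidHom) e.surjective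
  · intro G _ h
    infer_instance
  · intro G _ K _ hc hK
    have : Group.IsSolvable (G ⧸ K) :=
      Group.isSolvable_of_comm (IsCyclic.commGroup (α := G ⧸ K)).mul_comm
    exact Group.isSolvable_of_ker_le_range K.subtype (QuotientGroup.mk' K) (by simp)

theorem Subgroup.fg_of_wellFoundedGT {G : Type*} [Group G] (h : WellFoundedGT (Subgroup G))
    (H : Subgroup G) : H.FG := by
  obtain ⟨K, ⟨hK, hfg⟩, hmax⟩ := h.wf.has_min {K : Subgroup G | K ≤ H ∧ K.FG}
    ⟨⊥, bot_le, Subgroup.FG.bot⟩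
  convert hfg
  refine le_antisymm (fun x hx ↦ ?_) hK
  by_contra hxK
  refine hmax (K ⊔ Subgroup.zpowers x) ⟨?_, ?_⟩ ?_
  · exact sup_le hK (by simpa using hx)
  · exact hfg.sup ⟨{x}, by simp [Subgroup.zpowers_eq_closure]⟩
  · refine lt_of_le_of_ne le_sup_left fun he ↦ hxK ?_
    rw [he]
    exact (le_sup_right : Subgroup.zpowers x ≤ _) (Subgroup.mem_zpowers x)

theorem IsPolycyclic.of_mulEquiv {G H : Type u} [Group G] [Group H] (e : G ≃* H)
    (hG : IsPolycyclic G) : IsPolycyclic H := by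
  refine IsPolycyclic.induction (P := fun G _ ↦ ∀ (H : Type u) [Group H], G ≃* H →
    IsPolycyclic H) ?_ ?_ ?_ hG H e
  · exact fun G G' _ _ e h H _ e' ↦ h H (e.trans e')
  · intro G _ h H _ e
    have := e.symm.injective.subsingleton
    exact IsPolycyclic.of_subsingleton H
  · intro G _ K _ hc hK H _ e
    have hN : (K.map e.toMonoidHom).Normal := ‹K.Normal›.map _ e.surjective
    refine IsPolycyclic.of_isCyclic_quotient (K.map e.toMonoidHom) ?_
      (hK _ (K.equivMapOfInjective e.toMonoidHom e.injective))
    refine isCyclic_of_surjective (QuotientGroup.map K (K.map e.toMonoidHom) e.toMonoidHom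
      (Subgroup.le_comap_map _ _)) fun x ↦ ?_
    obtain ⟨y, rfl⟩ := QuotientGroup.mk_surjective x
    obtain ⟨z, rfl⟩ := e.surjective y
    exact ⟨QuotientGroup.mk z, rfl⟩

theorem IsPolycyclic.of_commutator {G : Type u} [Group G] (h : WellFoundedGT (Subgroup G))
    (hc : IsPolycyclic (commutator G)) : IsPolycyclic G := by
  obtain ⟨K, ⟨hK, hp⟩, hmax⟩ := h.wf.has_min
    {K : Subgroup G | commutator G ≤ K ∧ IsPolycyclic K} ⟨_, le_rfl, hc⟩
  suffices hT : K = ⊤ by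
    rw [hT] at hp
    exact hp.of_mulEquiv Subgroup.topEquiv
  by_contra hT
  obtain ⟨x, hx⟩ : ∃ x, x ∉ K := by
    by_contra! hall
    exact hT (Subgroup.eq_top_iff' K |>.mpr hall)
  have hN : K.Normal := Subgroup.Normal.of_commutator_le G hK
  have hle : K ≤ K ⊔ Subgroup.zpowers x := le_sup_left
  have hxL : x ∈ K ⊔ Subgroup.zpowers x :=
    (le_sup_right : Subgroup.zpowers x ≤ _) (Subgroup.mem_zpowers x)
  refine hmax (K ⊔ Subgroup.zpowers x) ⟨hK.trans hle, ?_⟩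
    (lt_of_le_of_ne hle fun he ↦ hx (he ▸ hxL))
  refine IsPolycyclic.of_isCyclic_quotient (K.subgroupOf (K ⊔ Subgroup.zpowers x)) ?_
    (hp.of_mulEquiv (Subgroup.subgroupOfEquivOfLe hle).symm)
  refine ⟨QuotientGroup.mk ⟨x, hxL⟩, fun y ↦ ?_⟩
  obtain ⟨⟨y, hy⟩, rfl⟩ := QuotientGroup.mk_surjective y
  obtain ⟨k, hk, z, ⟨m, rfl⟩, rfl⟩ := Subgroup.mem_sup_of_normal_left.mp hy
  refine ⟨m, ?_⟩
  change QuotientGroup.mk ((⟨x, hxL⟩ : (K ⊔ Subgroup.zpowers x : Subgroup G)) ^ m) = _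
  rw [QuotientGroup.eq, Subgroup.mem_subgroupOf]
  simpa [mul_assoc] using hN.conj_mem k hk (x ^ m)⁻¹

theorem IsPolycyclic.of_isSolvable {G : Type u} [Group G] (hs : Group.IsSolvable G)
    (h : WellFoundedGT (Subgroup G)) : IsPolycyclic G := by
  have key : ∀ n, IsPolycyclic (derivedSeries G n) → IsPolycyclic G := by
    intro n
    induction n with
    | zero => exact fun hp ↦ hp.of_mulEquiv Subgroup.topEquiv
    | succ n ih =>
      refine fun hp ↦ ih (IsPolycyclic.of_commutator ?_ ?_)
      · exact (Monotone.strictMono_of_injective (fun _ _ h ↦ Subgroup.map_mono h)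
          (Subgroup.map_injective (derivedSeries G n).subtype_injective)).wellFoundedGT
      · refine hp.of_mulEquiv (((commutator (derivedSeries G n)).equivMapOfInjective _
          (derivedSeries G n).subtype_injective).trans (MulEquiv.subgroupCongr ?_)).symm
        rw [commutator_def, Subgroup.map_commutator, ← MonoidHom.range_eq_map,
          Subgroup.range_subtype, derivedSeries_succ]
  obtain ⟨n, hn⟩ := hs
  refine key n ?_
  rw [hn]
  exact IsPolycyclic.of_subsingleton _

open scoped commutatorElement in
theorem derivedSeries_le_sup_of_commutator_le {G : Type*} [Group G] {A B : Subgroup G} [A.Normal]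
    [B.Normal] (hAB : ⁅A, A⁆ ≤ B) {k : ℕ} (hk : derivedSeries G k ≤ derivedSeries G (k + 1) ⊔ A) :
    derivedSeries G (k + 1) ≤ derivedSeries G (k + 2) ⊔ B := by
  have hsup : ∀ X Y Z : Subgroup G, X.Normal → Y.Normal → Z.Normal →
      (⁅X ⊔ Y, Z⁆ : Subgroup G) ≤ (⁅X, Z⁆ ⊔ ⁅Y, Z⁆ : Subgroup G) := by
    intro X Y Z hX hY hZ
    rw [Subgroup.commutator_le]
    intro g hg z hz
    obtain ⟨x, hx, y, hy, rfl⟩ := Subgroup.mem_sup_of_normal_left.mp hg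
    have : ⁅x * y, z⁆ = x * ⁅y, z⁆ * x⁻¹ * ⁅x, z⁆ := by
      simp only [commutatorElement_def]; group
    rw [this]
    refine Subgroup.mul_mem _ ?_ ?_
    · exact (le_sup_right : ⁅Y, Z⁆ ≤ _) ((Subgroup.commutator_normal Y Z).conj_mem _
        (Subgroup.commutator_mem_commutator hy hz) x)
    · exact (le_sup_left : ⁅X, Z⁆ ≤ _) (Subgroup.commutator_mem_commutator hx hz)
  set D := derivedSeries G k
  have hD : D.Normal := derivedSeries_normal G k
  have hD₁ : derivedSeries G (k + 1) = ⁅D, D⁆ := derivedSeries_succ G k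
  have hD₂ : derivedSeries G (k + 2) = ⁅⁅D, D⁆, ⁅D, D⁆⁆ := by
    rw [derivedSeries_succ, hD₁]
  rw [hD₁] at hk
  rw [hD₂, hD₁]
  have hE : (⁅D, D⁆ : Subgroup G).Normal := inferInstance
  set E := ⁅D, D⁆
  have hF : (⁅E, E⁆ : Subgroup G).Normal := inferInstance
  have hFB : (⁅E, E⁆ ⊔ B : Subgroup G).Normal := inferInstance
  have step : ∀ X : Subgroup G, X.Normal →
      (⁅E ⊔ A, X⁆ : Subgroup G) ≤ (⁅E, X⁆ ⊔ ⁅A, X⁆ : Subgroup G) :=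
    fun X hX ↦ hsup E A X hE ‹_› hX
  have h₁ : E ≤ ⁅E, E⁆ ⊔ B ⊔ ⁅E, A⁆ :=
    calc E ≤ ⁅E ⊔ A, E ⊔ A⁆ := Subgroup.commutator_mono hk hk
      _ ≤ ⁅E, E ⊔ A⁆ ⊔ ⁅A, E ⊔ A⁆ := step _ inferInstance
      _ ≤ ⁅E, E⁆ ⊔ B ⊔ ⁅E, A⁆ := by
        rw [Subgroup.commutator_comm E, Subgroup.commutator_comm A]
        refine sup_le ((step _ hE).trans (sup_le ?_ ?_)) ((step _ ‹_›).trans (sup_le ?_ ?_))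
        · exact le_sup_left.trans le_sup_left
        · rw [Subgroup.commutator_comm]
          exact le_sup_right
        · exact le_sup_right
        · exact hAB.trans (le_sup_right.trans le_sup_left)
  have h₂ : ⁅E, A⁆ ≤ ⁅E, E⁆ ⊔ B :=
    calc ⁅E, A⁆ ≤ ⁅⁅E, E⁆ ⊔ B ⊔ ⁅E, A⁆, A⁆ := Subgroup.commutator_mono h₁ le_rfl
      _ ≤ ⁅⁅E, E⁆ ⊔ B, A⁆ ⊔ ⁅⁅E, A⁆, A⁆ := hsup _ _ _ hFB inferInstance ‹_›
      _ ≤ ⁅E, E⁆ ⊔ B := sup_le (Subgroup.commutator_le_left _ _)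
        ((Subgroup.commutator_mono (Subgroup.commutator_le_right _ _) le_rfl).trans
          (hAB.trans le_sup_right))
  exact h₁.trans (sup_le le_rfl h₂)

theorem exists_derivedSeries_eq_succ {G : Type*} [Group G] (N : Subgroup G) [N.Normal]
    [N.FiniteIndex] (hN : Group.IsSolvable N) :
    ∃ k, derivedSeries G k = derivedSeries G (k + 1) := by
  have key : ∀ j, ∃ k, derivedSeries G k ≤
      derivedSeries G (k + 1) ⊔ (derivedSeries N j).map N.subtype := by
    intro j
    induction j with
    | zero =>
      obtain ⟨k, hk⟩ := WellFoundedGT.monotone_chain_condition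
        (α := (Subgroup (G ⧸ N))ᵒᵈ) ⟨fun n ↦ OrderDual.toDual (derivedSeries (G ⧸ N) n),
          fun a b hab ↦ derivedSeries_antitone _ hab⟩
      refine ⟨k, fun x hx ↦ ?_⟩
      have hk' : derivedSeries (G ⧸ N) k = derivedSeries (G ⧸ N) (k + 1) := hk (k + 1) k.le_succ
      have hsurj := QuotientGroup.mk'_surjective N
      rw [← map_derivedSeries_eq hsurj, ← map_derivedSeries_eq hsurj] at hk'
      obtain ⟨y, hy, hyx⟩ : QuotientGroup.mk' N x ∈
        (derivedSeries G (k + 1)).map (QuotientGroup.mk' N) := hk' ▸ Subgroup.mem_map_of_mem _ hx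
      have hyN : y⁻¹ * x ∈ N := QuotientGroup.eq.mp hyx
      rw [derivedSeries_zero, ← MonoidHom.range_eq_map, Subgroup.range_subtype]
      simpa using Subgroup.mul_mem_sup hy hyN
    | succ j ih =>
      obtain ⟨k, hk⟩ := ih
      refine ⟨k + 1, derivedSeries_le_sup_of_commutator_le ?_ hk⟩
      rw [derivedSeries_succ, Subgroup.map_commutator]
  obtain ⟨n, hn⟩ := hN
  obtain ⟨k, hk⟩ := key n
  refine ⟨k, le_antisymm ?_ (derivedSeries_antitone _ k.le_succ)⟩
  simpa [hn] using hk

/-- A polycyclic-by-finite group which is not polycyclic contains a nontrivial perfect subgroup. -/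
theorem IsPolycyclicByFinite.exists_perfect_subgroup {G : Type u} [Group G]
    (hG : IsPolycyclicByFinite G) (hnp : ¬ IsPolycyclic G) :
    ∃ H : Subgroup G, H ≠ ⊥ ∧ H.FG ∧ ⁅H, H⁆ = H := by
  have hw := hG.wellFoundedGT
  obtain ⟨N, hN, hfin, hp⟩ := hG
  obtain ⟨k, hk⟩ := exists_derivedSeries_eq_succ N hp.isSolvable
  refine ⟨derivedSeries G k, fun hb ↦ hnp (IsPolycyclic.of_isSolvable ⟨k, hb⟩ hw),
    Subgroup.fg_of_wellFoundedGT hw _, ?_⟩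
  rw [← derivedSeries_succ, ← hk]

theorem Subgroup.FiniteIndex.map_subtype {G : Type*} [Group G] {K : Subgroup G} (L : Subgroup K)
    (hL : L.FiniteIndex) (hK : K.FiniteIndex) : (L.map K.subtype).FiniteIndex := by
  refine ⟨?_⟩
  rw [Subgroup.index_map_subtype]
  exact mul_ne_zero hL.index_ne_zero hK.index_ne_zero

/-- In a finitely generated normal subgroup `K` of `G`, every finite index subgroup of `K` contains
a finite index subgroup of `K` that is normal in `G`. -/
theorem Subgroup.exists_normal_finiteIndex_le {G : Type*} [Group G] (K : Subgroup G) [K.Normal]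
    (hK : Group.FG K) (L : Subgroup K) [L.FiniteIndex] :
    ∃ M : Subgroup K, M ≤ L ∧ M.FiniteIndex ∧ (M.map K.subtype).Normal := by
  have hfin : Finite (K →* Equiv.Perm (K ⧸ L)) := by
    obtain ⟨S, hS⟩ := hK
    refine Finite.of_injective (fun f (s : S) ↦ f s) fun f g hfg ↦ ?_
    exact MonoidHom.eq_of_eqOn_dense hS fun s hs ↦ congrFun hfg ⟨s, hs⟩
  refine ⟨⨅ f : K →* Equiv.Perm (K ⧸ L), f.ker, ?_, ?_, ⟨?_⟩⟩
  · refine (iInf_le _ (MulAction.toPermHom K (K ⧸ L))).trans ?_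
    rw [← Subgroup.normalCore_eq_ker]
    exact L.normalCore_le
  · exact Subgroup.finiteIndex_iInf fun f ↦ Subgroup.finiteIndex_ker f
  · rintro _ ⟨x, hx, rfl⟩ g
    refine ⟨MulAut.conjNormal g x, ?_, by simp⟩
    simp only [SetLike.mem_coe, Subgroup.mem_iInf, MonoidHom.mem_ker] at hx ⊢
    exact fun f ↦ hx (f.comp (MulEquiv.toMonoidHom (MulAut.conjNormal (H := K) g)))

theorem Group.ResiduallyFinite.of_finiteIndex {G : Type*} [Group G] (K : Subgroup G)
    [K.FiniteIndex] (h : Group.ResiduallyFinite K) : Group.ResiduallyFinite G := by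
  rw [Group.residuallyFinite_iff_exists_finiteIndex] at h ⊢
  intro g hg
  by_cases hgK : g ∈ K
  · obtain ⟨L, hL, hgL⟩ := h ⟨g, hgK⟩ fun he ↦ hg (congrArg Subtype.val he)
    refine ⟨L.map K.subtype, Subgroup.FiniteIndex.map_subtype L hL ‹_›, ?_⟩
    rintro ⟨x, hx, rfl⟩
    exact hgL hx
  · exact ⟨K, ‹_›, hgK⟩

theorem Group.ResiduallyFinite.of_isCyclic (G : Type*) [Group G] [IsCyclic G] :
    Group.ResiduallyFinite G := by
  cases finite_or_infinite G
  · infer_instance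
  rw [Group.residuallyFinite_iff_exists_finiteIndex]
  obtain ⟨t, ht⟩ := IsCyclic.exists_generator (α := G)
  intro g hg
  obtain ⟨m, rfl⟩ := ht g
  have hm : m ≠ 0 := by
    rintro rfl
    exact hg (zpow_zero t)
  have hord : orderOf t = 0 := Infinite.orderOf_eq_zero_of_forall_mem_zpowers ht
  have hinj : Function.Injective fun n : ℤ ↦ t ^ n :=
    injective_zpow_iff_not_isOfFinOrder.mpr (orderOf_eq_zero_iff.mp hord)
  refine ⟨Subgroup.zpowers (t ^ (2 * m)), ?_, ?_⟩
  · set H := Subgroup.zpowers (t ^ (2 * m)) with hH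
    have hN : H.Normal := ⟨fun n hn g ↦ by
      rwa [(IsCyclic.commGroup (α := G)).mul_comm g n, mul_inv_cancel_right]⟩
    have hfin : Finite (G ⧸ H) := by
      by_contra hinf
      rw [not_finite_iff_infinite] at hinf
      have ht' : ∀ x : G ⧸ H, x ∈ Subgroup.zpowers (QuotientGroup.mk t : G ⧸ H) := by
        intro x
        obtain ⟨y, rfl⟩ := QuotientGroup.mk_surjective x
        obtain ⟨n, rfl⟩ := ht y
        exact ⟨n, rfl⟩
      have h0 := orderOf_eq_zero_iff.mp (Infinite.orderOf_eq_zero_of_forall_mem_zpowers ht')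
      have hpow : (QuotientGroup.mk t : G ⧸ H) ^ (2 * m) = (QuotientGroup.mk t : G ⧸ H) ^ (0 : ℤ) :=
        (QuotientGroup.eq_one_iff (t ^ (2 * m))).mpr (Subgroup.mem_zpowers _) |>.trans
          (zpow_zero _).symm
      have := injective_zpow_iff_not_isOfFinOrder.mpr h0 hpow
      omega
    exact Subgroup.finiteIndex_of_finite_quotient
  · rintro ⟨n, hn⟩
    have : 2 * m * n = m := hinj (by simpa [zpow_mul] using hn)
    have : 2 * n = 1 := by
      refine mul_left_cancel₀ hm ?_
      linarith
    omega

theorem Group.ResiduallyFinite.of_isCyclic_quotient {G : Type*} [Group G] (K : Subgroup G)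
    [K.Normal] (hc : IsCyclic (G ⧸ K)) (hfg : Group.FG K) (h : Group.ResiduallyFinite K) :
    Group.ResiduallyFinite G := by
  cases finite_or_infinite (G ⧸ K)
  · have : K.FiniteIndex := Subgroup.finiteIndex_of_finite_quotient
    exact .of_finiteIndex K h
  rw [Group.residuallyFinite_iff_exists_finiteIndex]
  intro g hg
  by_cases hgK : g ∈ K
  · obtain ⟨t, ht⟩ := IsCyclic.exists_generator (α := G ⧸ K)
    obtain ⟨t, rfl⟩ := QuotientGroup.mk_surjective t
    have hord := Infinite.orderOf_eq_zero_of_forall_mem_zpowers ht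
    obtain ⟨L, hL, hgL⟩ := Group.residuallyFinite_iff_exists_finiteIndex.mp h ⟨g, hgK⟩
      fun he ↦ hg (congrArg Subtype.val he)
    obtain ⟨M, hML, hM, hMn⟩ := K.exists_normal_finiteIndex_le hfg L
    set A := M.map K.subtype ⊔ Subgroup.zpowers t with hA
    refine ⟨A, ?_, ?_⟩
    · have hle : M ≤ A.comap K.subtype := Subgroup.map_le_iff_le_comap.mp le_sup_left
      have hsurj : Function.Surjective (fun x : K ⧸ M ↦
          Quotient.map' (s₁ := QuotientGroup.leftRel M)
          (s₂ := QuotientGroup.leftRel A) (fun k ↦ (k : G)) (fun a b hab ↦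
            QuotientGroup.leftRel_apply.mpr (hle (QuotientGroup.leftRel_apply.mp hab))) x) := by
        intro x
        obtain ⟨x, rfl⟩ := QuotientGroup.mk_surjective x
        obtain ⟨m, hm⟩ := ht (QuotientGroup.mk x)
        have hx : x * (t ^ m)⁻¹ ∈ K := by
          have := QuotientGroup.eq.mp hm
          exact (‹K.Normal›.mem_comm_iff).mp this
        refine ⟨QuotientGroup.mk ⟨_, hx⟩, QuotientGroup.eq.mpr ?_⟩
        simpa using (le_sup_right : _ ≤ A) (Subgroup.zpow_mem_zpowers t m)
      have := Finite.of_surjective _ hsurj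
      exact Subgroup.finiteIndex_of_finite_quotient (H := A)
    · intro hgA
      obtain ⟨x, ⟨y, hy, rfl⟩, _, ⟨m, rfl⟩, hxm⟩ := Subgroup.mem_sup_of_normal_left.mp hgA
      have htm : t ^ m ∈ K := by
        have : t ^ m = (y : G)⁻¹ * g := by simp [← hxm]
        rw [this]
        exact K.mul_mem (K.inv_mem y.2) hgK
      have hm : m = 0 := by
        refine injective_zpow_iff_not_isOfFinOrder.mpr (orderOf_eq_zero_iff.mp hord) ?_
        simpa using (QuotientGroup.eq_one_iff (N := K) (t ^ m)).mpr htm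
      subst hm
      refine hgL (hML ?_)
      have : (⟨g, hgK⟩ : K) = y := Subtype.ext (by simpa using hxm.symm)
      rwa [this]
  · have hQ := Group.ResiduallyFinite.of_isCyclic (G ⧸ K)
    obtain ⟨L, hL, hgL⟩ := Group.residuallyFinite_iff_exists_finiteIndex.mp hQ
      (QuotientGroup.mk g) fun he ↦ hgK ((QuotientGroup.eq_one_iff g).mp he)
    exact ⟨L.comap (QuotientGroup.mk' K), ⟨(L.index_comap_of_surjective
      (QuotientGroup.mk'_surjective K)).trans_ne hL.index_ne_zero⟩, hgL⟩

theorem IsPolycyclic.residuallyFinite {G : Type u} [Group G] (hG : IsPolycyclic G) :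
    Group.ResiduallyFinite G := by
  refine (IsPolycyclic.induction (P := fun G _ ↦ WellFoundedGT (Subgroup G) ∧
    Group.ResiduallyFinite G) ?_ ?_ ?_ hG).2
  · intro G H _ _ e ⟨h, h'⟩
    refine ⟨Subgroup.wellFoundedGT_of_surjective e.toMonoidHom e.surjective h, ?_⟩
    rw [Group.residuallyFinite_iff_exists_finiteIndex] at h' ⊢
    intro g hg
    obtain ⟨L, hL, hgL⟩ := h' (e.symm g) (by simpa using hg)
    exact ⟨L.comap e.symm.toMonoidHom, ⟨(L.index_comap_of_surjective
      e.symm.surjective).trans_ne hL.index_ne_zero⟩, hgL⟩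
  · intro G _ h
    exact ⟨inferInstance, inferInstance⟩
  · intro G _ K _ hc ⟨hw, hK⟩
    exact ⟨Subgroup.wellFoundedGT_of_extension K hw (Subgroup.wellFoundedGT_of_isCyclic _),
      .of_isCyclic_quotient K hc ⟨Subgroup.fg_of_wellFoundedGT hw ⊤⟩ hK⟩

theorem IsPolycyclicByFinite.residuallyFinite {G : Type u} [Group G]
    (hG : IsPolycyclicByFinite G) : Group.ResiduallyFinite G := by
  obtain ⟨N, hN, hfin, hp⟩ := hG
  exact .of_finiteIndex N hp.residuallyFinite

section ProjectiveLimit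

variable {S : Type u} [Ring S] {ι : Type} [Fintype ι] (x : ι → S) (b : ι → ι → ι → S)

/-- The endomorphism `[w] ↦ ∑ i, x i [i :: w]` of the free module on words. -/
noncomputable def wordShift : (List ι →₀ S) →ₗ[S] (List ι →₀ S) :=
  Finsupp.linearCombination S fun w ↦ ∑ i, Finsupp.single (i :: w) (x i)

/-- The value on a word of the map `wordUnshift`. -/
noncomputable def wordUnshiftFun : List ι → (List ι →₀ S)
  | j :: i :: w => ∑ l, Finsupp.single (l :: w) (b l i j)
  | _ => 0

/-- The endomorphism `[j :: i :: w] ↦ ∑ l, b l i j [l :: w]` of the free module on words,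
vanishing on words of length at most one. -/
noncomputable def wordUnshift : (List ι →₀ S) →ₗ[S] (List ι →₀ S) :=
  Finsupp.linearCombination S (wordUnshiftFun b)

/-- The sum of the maps `B ^ (m + 1) * A`, where `A` is the shift and `B` the unshift, truncated at
the length of the word. -/
noncomputable def wordRetract : (List ι →₀ S) →ₗ[S] (List ι →₀ S) :=
  Finsupp.linearCombination S fun w ↦ ∑ m ∈ Finset.range (w.length + 1),
    (wordUnshift b ^ (m + 1)) (wordShift x (Finsupp.single w 1))

theorem wordShift_single (w : List ι) :
    wordShift x (Finsupp.single w 1) = ∑ i, x i • Finsupp.single (i :: w) 1 := by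
  simp [wordShift]

variable {x b}

theorem wordUnshift_wordShift_wordShift (hx : ∀ l, ∑ i, ∑ j, x i * x j * b l i j = x l)
    (v : List ι →₀ S) : wordUnshift b (wordShift x (wordShift x v)) = wordShift x v := by
  suffices h : wordUnshift b ∘ₗ wordShift x ∘ₗ wordShift x = wordShift x from
    LinearMap.congr_fun h v
  ext1 w
  ext1
  simp only [LinearMap.comp_apply, Finsupp.lsingle_apply, wordShift_single, map_sum, map_smul]
  simp only [wordUnshift, Finsupp.linearCombination_single, one_smul, wordUnshiftFun,
    Finset.smul_sum, Finsupp.smul_single, smul_eq_mul, mul_one]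
  have h (l : ι) : Finsupp.single (l :: w) (x l) =
      ∑ i, ∑ j, Finsupp.single (l :: w) (x i * (x j * b l i j)) := by
    conv_lhs => rw [← hx l]
    simp only [Finsupp.single_finsetSum, mul_assoc]
  simp only [h]
  rw [Finset.sum_comm_cycle, Finset.sum_comm]

theorem wordRetract_wordShift (hx : ∀ l, ∑ i, ∑ j, x i * x j * b l i j = x l)
    (v : List ι →₀ S) : wordRetract x b (wordShift x v) = wordShift x v + wordRetract x b v := by
  suffices h : wordRetract x b ∘ₗ wordShift x = wordShift x + wordRetract x b from
    LinearMap.congr_fun h v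
  ext1 w
  ext1
  have hw : ∀ i, wordRetract x b (Finsupp.single (i :: w) 1) =
      ∑ m ∈ Finset.range (w.length + 2),
        (wordUnshift b ^ (m + 1)) (wordShift x (Finsupp.single (i :: w) 1)) := by
    simp [wordRetract]
  have hw' : wordRetract x b (Finsupp.single w 1) = ∑ m ∈ Finset.range (w.length + 1),
      (wordUnshift b ^ (m + 1)) (wordShift x (Finsupp.single w 1)) := by
    simp [wordRetract]
  simp only [LinearMap.comp_apply, Finsupp.lsingle_apply, LinearMap.add_apply, hw']
  calc wordRetract x b (wordShift x (Finsupp.single w 1))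
      = ∑ m ∈ Finset.range (w.length + 2), (wordUnshift b ^ (m + 1))
          (wordShift x (wordShift x (Finsupp.single w 1))) := by
        rw [wordShift_single]
        simp only [map_sum, map_smul, hw, Finset.smul_sum]
        rw [Finset.sum_comm]
    _ = ∑ m ∈ Finset.range (w.length + 2), (wordUnshift b ^ m)
          (wordShift x (Finsupp.single w 1)) := by
        refine Finset.sum_congr rfl fun m _ ↦ ?_
        rw [pow_succ, Module.End.mul_apply, wordUnshift_wordShift_wordShift hx]
    _ = _ := by
        rw [Finset.sum_range_succ', add_comm, pow_zero, Module.End.one_apply]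

theorem exists_projective_of_sum_mul_eq {T : Type*} [Semiring T] (ε : S →+* T)
    (hx : ∀ l, ∑ i, ∑ j, x i * x j * b l i j = x l) (hne : ∃ i, x i ≠ 0)
    (hε : ∀ i, ε (x i) = 0) :
    ∃ (P : Type u) (_ : AddCommGroup P) (_ : Module S P), Nontrivial P ∧ Module.Projective S P ∧
      ∀ (f : P →ₗ[S] S) (p : P), ε (f p) = 0 := by
  let φ : (List ι →₀ S) →ₗ[S] (List ι →₀ S) := LinearMap.id - wordShift x
  let ψ : (List ι →₀ S) →ₗ[S] (List ι →₀ S) := LinearMap.id - wordRetract x b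
  have hψφ : ∀ v, ψ (φ v) = v := by
    intro v
    simp only [φ, ψ, LinearMap.sub_apply, LinearMap.id_apply, map_sub, wordRetract_wordShift hx]
    abel
  have hP : ∀ v : List ι →₀ S, (φ.range.mkQ v) = φ.range.mkQ (wordShift x v) := by
    intro v
    rw [← sub_eq_zero, ← map_sub]
    exact (Submodule.Quotient.mk_eq_zero _).mpr ⟨v, by simp [φ]⟩
  refine ⟨(List ι →₀ S) ⧸ φ.range, inferInstance, inferInstance, ?_, ?_, ?_⟩
  · rw [Submodule.Quotient.nontrivial_iff]
    intro htop
    obtain ⟨v, hv⟩ : Finsupp.single [] 1 ∈ φ.range := htop ▸ Submodule.mem_top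
    have hU : wordRetract x b (Finsupp.single [] 1) = 0 := by
      simp [wordRetract, wordShift, wordUnshift, wordUnshiftFun]
    have hv' : v = Finsupp.single [] 1 := by
      rw [← hψφ v, hv]
      simp [ψ, hU]
    obtain ⟨i, hi⟩ := hne
    rw [hv'] at hv
    have hA : wordShift x (Finsupp.single [] 1) = 0 := by simpa [φ] using hv
    apply hi
    have := DFunLike.congr_fun hA [i]
    classical
    simpa [wordShift, Finsupp.finsetSum_apply, Finsupp.single_apply] using this
  · refine Module.Projective.of_split
      (φ.range.liftQ (LinearMap.id - φ ∘ₗ ψ) ?_) φ.range.mkQ ?_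
    · rintro _ ⟨v, rfl⟩
      simp [hψφ]
    · ext1
      ext1 w
      ext1
      simp
  · intro f p
    obtain ⟨v, rfl⟩ := φ.range.mkQ_surjective p
    induction v using Finsupp.induction_linear with
    | zero => simp
    | add v w hv hw => simp only [map_add, hv, hw, add_zero]
    | single w c =>
      have hc : Finsupp.single w c = c • Finsupp.single w (1 : S) := by simp
      rw [hc, map_smul, map_smul, smul_eq_mul, map_mul, hP, wordShift_single]
      simp only [map_sum, map_smul, smul_eq_mul, map_mul, hε, zero_mul, Finset.sum_const_zero,
        mul_zero]

end ProjectiveLimit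

section PerfectRelation

variable {G R : Type*} [Group G] [Ring R] (u : G →* R)

theorem MonoidHom.map_mul_sub_one (g h : G) : u (g * h) - 1 = u g * (u h - 1) + (u g - 1) := by
  rw [map_mul, mul_sub, mul_one]
  abel

theorem MonoidHom.map_inv_sub_one (g : G) : u g⁻¹ - 1 = -(u g⁻¹ * (u g - 1)) := by
  rw [mul_sub, ← map_mul, inv_mul_cancel, map_one, mul_one]
  abel

/-- The subgroup of all `g` such that `u g` is congruent to `1` modulo a left ideal. -/
def MonoidHom.congruenceSubgroup (J : Ideal R) : Subgroup G where
  carrier := {g | u g - 1 ∈ J}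
  one_mem' := by simp
  mul_mem' {g h} hg hh := by
    rw [Set.mem_ofPred_eq, u.map_mul_sub_one]
    exact J.add_mem (J.mul_mem_left _ hh) hg
  inv_mem' {g} hg := by
    rw [Set.mem_ofPred_eq, u.map_inv_sub_one]
    exact J.neg_mem (J.mul_mem_left _ hg)

theorem MonoidHom.sub_one_mul_sub_one_mem {ι : Type*} {s : ι → G} {J : Ideal R}
    (hJ : ∀ i j, (u (s i) - 1) * (u (s j) - 1) ∈ J) {g h : G}
    (hg : g ∈ Subgroup.closure (Set.range s)) (hh : h ∈ Subgroup.closure (Set.range s)) :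
    (u g - 1) * (u h - 1) ∈ J := by
  have key : ∀ g ∈ Subgroup.closure (Set.range s), ∀ j, (u g - 1) * (u (s j) - 1) ∈ J := by
    intro g hg j
    induction hg using Subgroup.closure_induction with
    | mem g hg =>
      obtain ⟨i, rfl⟩ := hg
      exact hJ i j
    | one => simp
    | mul g h _ _ hg hh =>
      rw [u.map_mul_sub_one, add_mul, mul_assoc]
      exact J.add_mem (J.mul_mem_left _ hh) hg
    | inv g _ hg =>
      rw [u.map_inv_sub_one, neg_mul, mul_assoc]
      exact J.neg_mem (J.mul_mem_left _ hg)
  induction hh using Subgroup.closure_induction generalizing g with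
  | mem h hh =>
    obtain ⟨i, rfl⟩ := hh
    exact key g hg i
  | one => simp
  | mul h k hh _ ihh ihk =>
    have : (u g - 1) * (u (h * k) - 1) =
        u h * ((u (h⁻¹ * g * h) - 1) * (u k - 1)) + (u g - 1) * (u h - 1) := by
      rw [u.map_mul_sub_one, mul_add, ← mul_assoc, ← mul_assoc, mul_sub (u h), ← map_mul]
      simp only [← mul_assoc, mul_inv_cancel, one_mul, map_mul, mul_one, sub_mul]
    rw [this]
    exact J.add_mem (J.mul_mem_left _ (ihk (mul_mem (mul_mem (inv_mem hh) hg) hh))) (ihh hg)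
  | inv h hh ih =>
    have : (u g - 1) * (u h⁻¹ - 1) =
        -(u h⁻¹ * ((u (h * g * h⁻¹) - 1) * (u h - 1))) := by
      rw [u.map_inv_sub_one, mul_neg, ← mul_assoc, ← mul_assoc, mul_sub (u h⁻¹), ← map_mul]
      simp only [← mul_assoc, inv_mul_cancel, one_mul, map_mul, mul_one, sub_mul]
    rw [this]
    exact J.neg_mem (J.mul_mem_left _ (ih (mul_mem (mul_mem hh hg) (inv_mem hh))))

open scoped commutatorElement in
theorem MonoidHom.sub_one_mem_of_commutator_eq {ι : Type*} {s : ι → G} {J : Ideal R}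
    (hJ : ∀ i j, (u (s i) - 1) * (u (s j) - 1) ∈ J) {H : Subgroup G}
    (hs : Subgroup.closure (Set.range s) = H) (hH : ⁅H, H⁆ = H) {g : G} (hg : g ∈ H) :
    u g - 1 ∈ J := by
  suffices h : H ≤ u.congruenceSubgroup J from h hg
  rw [← hH, Subgroup.commutator_le]
  intro g hg h hh
  have hm {a b : G} (ha : a ∈ H) (hb : b ∈ H) : (u a - 1) * (u b - 1) ∈ J :=
    u.sub_one_mul_sub_one_mem hJ (hs ▸ ha) (hs ▸ hb)
  have hc : ⁅g, h⁆ ∈ H := hH ▸ Subgroup.commutator_mem_commutator hg hh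
  have hgh : u g * u h = u ⁅g, h⁆ * u (h * g) := by
    simp only [← map_mul, commutatorElement_def]
    congr 1
    group
  have : u ⁅g, h⁆ - 1 = (u g - 1) * (u h - 1) - (u h - 1) * (u g - 1) -
      (u ⁅g, h⁆ - 1) * (u (h * g) - 1) := by
    have e : (u g - 1) * (u h - 1) - (u h - 1) * (u g - 1) = u g * u h - u (h * g) := by
      rw [map_mul]
      noncomm_ring
    rw [e, hgh]
    noncomm_ring
  change u ⁅g, h⁆ - 1 ∈ J
  rw [this]
  exact J.sub_mem (J.sub_mem (hm hg hh) (hm hh hg)) (hm hc (mul_mem hh hg))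

theorem MonoidHom.exists_sum_mul_sub_one_eq {H : Subgroup G} (hfg : H.FG) (hH : ⁅H, H⁆ = H)
    (hne : H ≠ ⊥) : ∃ (n : ℕ) (s : Fin n → G) (b : Fin n → Fin n → Fin n → R),
      (∃ i, s i ≠ 1) ∧
      ∀ l, ∑ i, ∑ j, b l i j * ((u (s j) - 1) * (u (s i) - 1)) = u (s l) - 1 := by
  obtain ⟨t, ht⟩ := hfg
  let s : Fin t.card → G := fun i ↦ t.equivFin.symm i
  have hs : Set.range s = t := by
    ext g
    simp only [s, Set.mem_range, Finset.mem_coe]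
    exact ⟨by rintro ⟨i, rfl⟩; exact (t.equivFin.symm i).2, fun hg ↦ ⟨t.equivFin ⟨g, hg⟩, by simp⟩⟩
  have hsH : Subgroup.closure (Set.range s) = H := by rw [hs, ht]
  have hmem (l) : u (s l) - 1 ∈ Ideal.span
      (Set.range fun p : Fin t.card × Fin t.card ↦ (u (s p.2) - 1) * (u (s p.1) - 1)) :=
    u.sub_one_mem_of_commutator_eq
      (fun i j ↦ Ideal.subset_span (Set.mem_range_self (j, i))) hsH hH
      (hsH ▸ Subgroup.subset_closure ⟨l, rfl⟩)
  simp only [Ideal.mem_span_range_iff_exists_fun] at hmem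
  choose c hc using hmem
  refine ⟨t.card, s, fun l i j ↦ c l (i, j), ?_, fun l ↦ ?_⟩
  · by_contra! h
    apply hne
    rw [← hsH, Subgroup.closure_eq_bot_iff]
    rintro _ ⟨i, rfl⟩
    exact h i
  · rw [← hc l, Fintype.sum_prod_type]

end PerfectRelation

theorem Matrix.exists_natCast_eq_trace_of_mul_self {ι : Type*} [Fintype ι] [DecidableEq ι]
    {M : Matrix ι ι ℤ} (hM : M * M = M) : ∃ r : ℕ, M.trace = r ∧ (r = 0 → M = 0) := by
  have he : IsIdempotentElem (Matrix.toLin' M) := by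
    rw [IsIdempotentElem, Module.End.mul_eq_comp, ← Matrix.toLin'_mul, hM]
  have htr := (LinearMap.IsIdempotentElem.isProj_range _ he).trace
  rw [Matrix.trace_toLin'_eq] at htr
  refine ⟨_, htr, fun h ↦ ?_⟩
  rw [h, Nat.cast_zero, ← Matrix.trace_toLin'_eq] at htr
  exact (map_eq_zero_iff _ (Matrix.toLin' (R := ℤ)).injective).mp
    (LinearMap.IsIdempotentElem.eq_zero_of_trace_eq_zero he htr)

open Polynomial in
theorem Polynomial.coeff_aeval_C_X_mul_X {A : Type*} [CommRing A] (f : A[X]) (j : ℕ) :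
    (aeval (C X * X : A[X][X]) f).coeff j = C (f.coeff j) * X ^ j := by
  induction f using Polynomial.induction_on' with
  | add f g hf hg => simp [hf, hg, add_mul]
  | monomial n a =>
    rw [aeval_monomial, mul_pow, ← C_pow, IsScalarTower.algebraMap_apply A A[X] A[X][X],
      algebraMap_eq, algebraMap_eq, ← mul_assoc, ← C_mul, coeff_C_mul, coeff_X_pow, coeff_monomial]
    by_cases h : j = n
    · simp [h]
    · simp [h, Ne.symm h]

open Polynomial in
theorem Polynomial.aeval_C_X {A : Type*} [CommRing A] (f : A[X]) :
    aeval (C X : A[X][X]) f = C f := by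
  induction f using Polynomial.induction_on' with
  | add f g hf hg => simp [hf, hg]
  | monomial n a =>
    rw [aeval_monomial, ← C_pow, IsScalarTower.algebraMap_apply A A[X] A[X][X],
      algebraMap_eq, algebraMap_eq, ← C_mul, C_mul_X_pow_eq_monomial]

open Polynomial in
theorem Polynomial.aeval_X_map_C {A : Type*} [CommRing A] (f : A[X]) :
    aeval (X : A[X][X]) f = f.map C := by
  rw [aeval_def, Polynomial.map]
  rfl

open Polynomial in
/-- The Goldman rank of an idempotent matrix: over a commutative ring with only the trivial
idempotents, the trace of an idempotent matrix is a natural number. -/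
theorem Matrix.exists_natCast_eq_trace_of_forall_idempotent {A : Type u} [CommRing A]
    (hA : ∀ a : A, a * a = a → a = 0 ∨ a = 1) {ι : Type*} [Fintype ι] [DecidableEq ι]
    {E : Matrix ι ι A} (hE : E * E = E) : ∃ r : ℕ, E.trace = r := by
  nontriviality A
  let F (B : Type u) [CommRing B] [Algebra A B] (z : B) : Matrix ι ι B :=
    (1 - E.map (algebraMap A B)) + z • E.map (algebraMap A B)
  have hEB (B : Type u) [CommRing B] [Algebra A B] :
      E.map (algebraMap A B) * E.map (algebraMap A B) = E.map (algebraMap A B) := by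
    rw [← Matrix.map_mul, hE]
  have hFmul (B : Type u) [CommRing B] [Algebra A B] (z w : B) : F B z * F B w = F B (z * w) := by
    simp only [F, add_mul, mul_add, sub_mul, mul_sub, one_mul, mul_one, smul_mul_assoc,
      mul_smul_comm]
    rw [hEB B, sub_self, zero_add, smul_smul, mul_comm w z]
    abel
  let f : A[X] := (F A[X] X).det
  have hf (B : Type u) [CommRing B] [Algebra A B] (z : B) : aeval z f = (F B z).det := by
    simp only [f]
    rw [AlgHom.map_det]
    congr 1
    ext i j
    simp [F, Matrix.one_apply, apply_ite, mul_comm z]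
  have hmul : C f * f.map C = aeval (C X * X : A[X][X]) f := by
    rw [← aeval_C_X, ← aeval_X_map_C, hf, hf, hf, ← Matrix.det_mul, hFmul]
  have hcoeff (i j : ℕ) : f.coeff i * f.coeff j = if i = j then f.coeff j else 0 := by
    have := congrArg (fun g : A[X][X] ↦ (g.coeff j).coeff i) hmul
    simpa [coeff_aeval_C_X_mul_X, coeff_C_mul, coeff_X_pow] using this
  have hone : f.eval 1 = 1 := by
    have := hf A 1
    rw [← coe_aeval_eq_eval]
    simpa [F] using this
  obtain ⟨r, hr⟩ : ∃ r, f.coeff r ≠ 0 := by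
    by_contra! h
    have : f = 0 := by ext i; simp [h i]
    simp [this] at hone
  have hr1 : f.coeff r = 1 := (hA _ (by simpa using hcoeff r r)).resolve_left hr
  have hfX : f = X ^ r := by
    ext i
    have := hcoeff i r
    rw [hr1, mul_one] at this
    rw [this, coeff_X_pow]
  refine ⟨r, ?_⟩
  have hp : Matrix.det (1 + (X : A[X]) • E.map C) = f.comp (X + 1) := by
    rw [comp_eq_aeval, hf]
    congr 1
    simp only [F, add_smul, one_smul, algebraMap_eq]
    abel
  rw [← Matrix.derivative_det_one_add_X_smul, hp, hfX]
  simp [derivative_pow]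

namespace MonoidAlgebra

variable {Γ C ι κ : Type*} [Group Γ] [Group C]

theorem coeff_mul_apply_eq_sum [Fintype Γ] (x y : MonoidAlgebra ℤ Γ) (g : Γ) :
    (x * y).coeff g = ∑ h, x.coeff h * y.coeff (h⁻¹ * g) := by
  rw [coeff_mul_apply_left, Finsupp.sum_fintype _ _ (by simp)]

section Restriction

variable [Fintype C] (y : κ → Γ) (φ : C →* Γ)

/-- If `y` is a left transversal of `φ.range`, this is the matrix over `ℤ[C]` obtained from a matrix
over `ℤ[Γ]` by viewing `ℤ[Γ]` as a free module over `ℤ[C]`. -/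
noncomputable def restrictMatrix (E : Matrix ι ι (MonoidAlgebra ℤ Γ)) :
    Matrix (ι × κ) (ι × κ) (MonoidAlgebra ℤ C) :=
  .of fun p q ↦ ofCoeff (Finsupp.equivFunOnFinite.symm
    fun c ↦ (E p.1 q.1).coeff (y p.2 * φ c * (y q.2)⁻¹))

variable {y φ}

theorem coeff_restrictMatrix (E : Matrix ι ι (MonoidAlgebra ℤ Γ)) (p q : ι × κ) (c : C) :
    (restrictMatrix y φ E p q).coeff c = (E p.1 q.1).coeff (y p.2 * φ c * (y q.2)⁻¹) := by
  simp [restrictMatrix]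

theorem restrictMatrix_mul [Fintype ι] [Fintype κ]
    (h : Function.Bijective fun p : κ × C ↦ y p.1 * φ p.2)
    (E F : Matrix ι ι (MonoidAlgebra ℤ Γ)) :
    restrictMatrix y φ (E * F) = restrictMatrix y φ E * restrictMatrix y φ F := by
  have : Fintype Γ := Fintype.ofBijective _ h
  ext ⟨i, a⟩ ⟨k, e⟩ c
  simp only [coeff_restrictMatrix, Matrix.mul_apply, coeff_sum, Finsupp.coe_finsetSum,
    Finset.sum_apply, coeff_mul_apply_eq_sum]
  rw [Fintype.sum_prod_type]
  refine Finset.sum_congr rfl fun j _ ↦ ?_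
  rw [← Fintype.sum_prod_type']
  let e₁ : κ × C ≃ Γ := (Equiv.prodCongr (Equiv.refl κ) (Equiv.inv C)).trans
    ((Equiv.ofBijective _ h).trans ((Equiv.inv Γ).trans (Equiv.mulLeft (y a))))
  refine (Fintype.sum_equiv e₁ _ _ fun p ↦ ?_).symm
  simp [e₁, mul_assoc]

theorem coeff_trace_restrictMatrix [Fintype ι] [Fintype κ] (E : Matrix ι ι (MonoidAlgebra ℤ Γ))
    (c : C) : (restrictMatrix y φ E).trace.coeff c =
      ∑ a, E.trace.coeff (y a * φ c * (y a)⁻¹) := by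
  simp only [Matrix.trace, Matrix.diag_apply, coeff_sum, Finsupp.coe_finsetSum, Finset.sum_apply,
    coeff_restrictMatrix]
  rw [Fintype.sum_prod_type, Finset.sum_comm]

end Restriction

variable [Fintype Γ]

theorem exists_natCast_eq_card_mul_trace_coeff_one [Fintype ι] [DecidableEq ι]
    {E : Matrix ι ι (MonoidAlgebra ℤ Γ)} (hE : E * E = E) :
    ∃ r : ℕ, Fintype.card Γ * E.trace.coeff 1 = r ∧ (r = 0 → E = 0) := by
  classical
  let π : MonoidAlgebra ℤ Unit →+* ℤ := (MonoidAlgebra.lift ℤ ℤ Unit 1).toRingHom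
  have hπ (x : MonoidAlgebra ℤ Unit) : π x = x.coeff 1 := by
    simp [π, lift_apply, Finsupp.sum_fintype]
  have hb : Function.Bijective fun p : Γ × Unit ↦ id p.1 * (1 : Unit →* Γ) p.2 := by
    simpa using (Equiv.prodPUnit Γ).bijective
  let F := restrictMatrix (id : Γ → Γ) (1 : Unit →* Γ) E
  have hF : F * F = F := by rw [← restrictMatrix_mul hb, hE]
  have hM : F.map π * F.map π = F.map π := by rw [← Matrix.map_mul, hF]
  obtain ⟨r, hr, hr0⟩ := Matrix.exists_natCast_eq_trace_of_mul_self hM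
  refine ⟨r, ?_, fun h ↦ ?_⟩
  · rw [← hr, ← AddMonoidHom.map_trace, hπ, coeff_trace_restrictMatrix]
    simp
  · ext i j g
    have := congrFun (congrFun (hr0 h) (i, g)) (j, 1)
    simpa [hπ, F, coeff_restrictMatrix] using this

theorem eq_zero_or_eq_one_of_mul_self {e : MonoidAlgebra ℤ Γ} (he : e * e = e) :
    e = 0 ∨ e = 1 := by
  have key {e : MonoidAlgebra ℤ Γ} (he : e * e = e) :
      0 ≤ e.coeff 1 ∧ (e.coeff 1 = 0 → e = 0) := by
    let E : Matrix Unit Unit (MonoidAlgebra ℤ Γ) := .of fun _ _ ↦ e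
    have hE : E * E = E := by
      ext1 i j
      simp [E, Matrix.mul_apply, he]
    obtain ⟨r, hr, hr0⟩ := exists_natCast_eq_card_mul_trace_coeff_one hE
    have ht : E.trace = e := by simp [E, Matrix.trace]
    rw [ht] at hr
    refine ⟨?_, fun h ↦ ?_⟩
    · have : (0 : ℤ) < Fintype.card Γ := by exact_mod_cast Fintype.card_pos
      exact nonneg_of_mul_nonneg_right (hr ▸ Int.natCast_nonneg r) this
    · have h0 : E = 0 := hr0 (by rw [h, mul_zero] at hr; exact_mod_cast hr.symm)
      exact congrFun (congrFun h0 ()) ()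
  obtain ⟨h1, h2⟩ := key he
  obtain ⟨h3, h4⟩ := key (e := 1 - e) (IsIdempotentElem.one_sub he)
  have h5 : (1 - e).coeff 1 = 1 - e.coeff 1 := by simp
  rw [h5] at h3 h4
  rcases (by omega : e.coeff 1 = 0 ∨ e.coeff 1 = 1) with h | h
  · exact Or.inl (h2 h)
  · exact Or.inr (sub_eq_zero.mp (h4 (by omega))).symm

theorem sum_trace_coeff_conj [Fintype ι] [DecidableEq ι]
    {E : Matrix ι ι (MonoidAlgebra ℤ Γ)} (hE : E * E = E) {g : Γ} (hg : g ≠ 1) :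
    ∑ a, E.trace.coeff (a * g * a⁻¹) = 0 := by
  classical
  let C := Subgroup.zpowers g
  let : CommGroup C := IsCyclic.commGroup
  let y : Γ ⧸ C → Γ := Quotient.out
  have hb : Function.Bijective fun p : (Γ ⧸ C) × C ↦ y p.1 * C.subtype p.2 := by
    have hmk (a : Γ ⧸ C) (c : C) : (QuotientGroup.mk (y a * c) : Γ ⧸ C) = a := by
      rw [QuotientGroup.mk_mul_of_mem _ c.2]
      exact Quotient.out_eq a
    refine ⟨?_, fun x ↦ ?_⟩
    · rintro ⟨a, c⟩ ⟨b, d⟩ h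
      have hab : a = b := by
        rw [← hmk a c, ← hmk b d]
        exact congrArg _ h
      subst hab
      simpa using h
    · have hx : (y x)⁻¹ * x ∈ C := QuotientGroup.eq.mp (Quotient.out_eq (x : Γ ⧸ C))
      exact ⟨(x, ⟨_, hx⟩), by simp⟩
  let F := restrictMatrix y C.subtype E
  have hF : F * F = F := by rw [← restrictMatrix_mul hb, hE]
  obtain ⟨r, hr⟩ := Matrix.exists_natCast_eq_trace_of_forall_idempotent
    (fun a ha ↦ eq_zero_or_eq_one_of_mul_self ha) hF
  let c : C := ⟨g, Subgroup.mem_zpowers g⟩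
  have h0 : F.trace.coeff c = 0 := by
    have hc : c ≠ 1 := fun h ↦ hg (congrArg Subtype.val h)
    rw [hr, coeff_natCast, Finsupp.single_eq_of_ne hc]
  rw [coeff_trace_restrictMatrix] at h0
  have hcomm (d : C) : (d : Γ) * g * (d : Γ)⁻¹ = g := by
    rw [mul_inv_eq_iff_eq_mul]
    exact congrArg Subtype.val (mul_comm d c)
  have hconj (a : Γ ⧸ C) (d : C) : y a * d * g * (y a * d)⁻¹ = y a * g * (y a)⁻¹ := by
    conv_rhs => rw [← hcomm d]
    group
  rw [← (Equiv.ofBijective _ hb).sum_comp, Fintype.sum_prod_type, Finset.sum_comm]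
  refine Finset.sum_eq_zero fun d _ ↦ ?_
  rw [← h0]
  exact Finset.sum_congr rfl fun a _ ↦ congrArg _ (hconj a d)

/-- An idempotent matrix over the integral group ring of a finite group vanishes as soon as its
augmentation does. -/
theorem eq_zero_of_mul_self_of_sum_coeff_eq_zero [Fintype ι] [DecidableEq ι]
    {E : Matrix ι ι (MonoidAlgebra ℤ Γ)} (hE : E * E = E)
    (h : ∑ g, E.trace.coeff g = 0) : E = 0 := by
  classical
  obtain ⟨r, hr, hr0⟩ := exists_natCast_eq_card_mul_trace_coeff_one hE
  refine hr0 ?_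
  have h1 : ∑ g, ∑ a, E.trace.coeff (a * g * a⁻¹) = 0 := by
    rw [Finset.sum_comm]
    refine Finset.sum_eq_zero fun a _ ↦ ?_
    rw [← h]
    exact (MulAut.conj a).toEquiv.sum_comp (fun g ↦ E.trace.coeff g)
  rw [Finset.sum_eq_single 1 (fun g _ hg ↦ sum_trace_coeff_conj hE hg) (by simp)] at h1
  have : (r : ℤ) = 0 := by
    rw [← hr, ← h1]
    simp
  exact_mod_cast this

end MonoidAlgebra

namespace MonoidAlgebra

variable {G : Type*} [Group G]

theorem exists_mapDomainRingHom_ne_zero [Group.ResiduallyFinite G] {x : MonoidAlgebra ℤ G}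
    (hx : x ≠ 0) : ∃ (N : Subgroup G) (_ : N.Normal), N.FiniteIndex ∧
      mapDomainRingHom ℤ (QuotientGroup.mk' N) x ≠ 0 := by
  let ι := {p : x.coeff.support × x.coeff.support // p.1 ≠ p.2}
  have hne (p : ι) : (p.1.1 : G) ≠ p.1.2 := fun h ↦ p.2 (Subtype.ext h)
  choose N hN using fun p : ι ↦
    Group.exists_finiteIndexNormalSubgroup_notMem ((p.1.1 : G)⁻¹ * p.1.2)
      fun h ↦ hne p (inv_mul_eq_one.mp h)
  let K : Subgroup G := ⨅ p, (N p).toSubgroup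
  have hKn : K.Normal := Subgroup.normal_iInf_normal fun p ↦ (N p).isNormal'
  refine ⟨K, hKn, Subgroup.finiteIndex_iInf fun p ↦ (N p).isFiniteIndex', fun h ↦ hx ?_⟩
  have hinj : Set.InjOn (QuotientGroup.mk' K) x.coeff.support := by
    intro g hg h hh hgh
    by_contra hne
    exact hN ⟨(⟨g, hg⟩, ⟨h, hh⟩), by simpa using hne⟩
      (Subgroup.mem_iInf.mp (QuotientGroup.eq.mp hgh) _)
  have h0 : Finsupp.mapDomain (QuotientGroup.mk' K) x.coeff = 0 := congrArg coeff h
  exact coeff_eq_zero.mp (Finsupp.mapDomain_injOn _ hinj (by simp) (by simp) (h0.trans (by simp)))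

/-- The augmentation of an integral group ring. -/
noncomputable def augmentation (G : Type*) [Group G] : MonoidAlgebra ℤ G →+* ℤ :=
  (MonoidAlgebra.lift ℤ ℤ G 1).toRingHom

@[simp]
theorem augmentation_single (g : G) (n : ℤ) : augmentation G (single g n) = n := by
  simp [augmentation]

theorem augmentation_eq_sum [Fintype G] (x : MonoidAlgebra ℤ G) :
    augmentation G x = ∑ g, x.coeff g := by
  simp [augmentation, lift_apply, Finsupp.sum_fintype]

theorem augmentation_mapDomainRingHom {H : Type*} [Group H] (f : G →* H) (x : MonoidAlgebra ℤ G) :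
    augmentation H (mapDomainRingHom ℤ f x) = augmentation G x := by
  suffices h : (augmentation H).comp (mapDomainRingHom ℤ f) = augmentation G from
    RingHom.congr_fun h x
  ext <;> simp

theorem eq_zero_of_mul_self_of_augmentation_eq_zero [Group.ResiduallyFinite G] {ι : Type*}
    [Fintype ι] [DecidableEq ι] {E : Matrix ι ι (MonoidAlgebra ℤ G)} (hE : E * E = E)
    (h : ∀ i, augmentation G (E i i) = 0) : E = 0 := by
  ext1 i j
  by_contra hij
  obtain ⟨N, _, _, hN⟩ := exists_mapDomainRingHom_ne_zero hij
  have : Fintype (G ⧸ N) := Fintype.ofFinite _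
  let π := mapDomainRingHom ℤ (QuotientGroup.mk' N)
  have hE0 : E.map π = 0 := by
    refine eq_zero_of_mul_self_of_sum_coeff_eq_zero (by rw [← Matrix.map_mul, hE]) ?_
    rw [← augmentation_eq_sum, Matrix.trace, map_sum]
    refine Finset.sum_eq_zero fun i _ ↦ ?_
    rw [← h i]
    exact augmentation_mapDomainRingHom _ _
  exact hN (congrFun (congrFun hE0 i) j)

theorem subsingleton_of_forall_augmentation_eq_zero [Group.ResiduallyFinite G] {Q : Type*}
    [AddCommGroup Q] [Module (MonoidAlgebra ℤ G)ᵐᵒᵖ Q] [Module.Projective (MonoidAlgebra ℤ G)ᵐᵒᵖ Q]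
    [Module.Finite (MonoidAlgebra ℤ G)ᵐᵒᵖ Q]
    (h : ∀ (f : Q →ₗ[(MonoidAlgebra ℤ G)ᵐᵒᵖ] (MonoidAlgebra ℤ G)ᵐᵒᵖ) (q : Q),
      augmentation G (f q).unop = 0) : Subsingleton Q := by
  obtain ⟨n, p, hp⟩ := Module.Finite.exists_fin' (MonoidAlgebra ℤ G)ᵐᵒᵖ Q
  obtain ⟨s, hs⟩ := Module.projective_lifting_property p LinearMap.id hp
  have hps (q : Q) : p (s q) = q := LinearMap.congr_fun hs q
  let b (i : Fin n) : Fin n → (MonoidAlgebra ℤ G)ᵐᵒᵖ := Pi.single i 1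
  have hb (v : Fin n → (MonoidAlgebra ℤ G)ᵐᵒᵖ) : v = ∑ i, v i • b i := by
    simpa [b] using (pi_eq_sum_univ' v)
  let E : Matrix (Fin n) (Fin n) (MonoidAlgebra ℤ G) := .of fun i j ↦ (s (p (b j)) i).unop
  have hE : E * E = E := by
    ext1 i j
    have key : s (p (b j)) = ∑ k, s (p (b j)) k • s (p (b k)) := by
      conv_lhs => rw [← hps (p (b j)), hb (s (p (b j)))]
      simp only [map_sum, map_smul]
    have := congrArg MulOpposite.unop (congrFun key i)
    simp only [E, Matrix.mul_apply, Matrix.of_apply]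
    rw [this]
    simp [Finset.sum_apply]
  have hE0 : E = 0 := eq_zero_of_mul_self_of_augmentation_eq_zero hE fun i ↦
    h (LinearMap.proj i ∘ₗ s) (p (b i))
  have hpb (j : Fin n) : p (b j) = 0 := by
    rw [← hps (p (b j))]
    have : s (p (b j)) = 0 := by
      ext1 i
      exact MulOpposite.unop_injective (congrFun (congrFun hE0 i) j)
    rw [this, map_zero]
  refine ⟨fun q r ↦ ?_⟩
  have h0 (q : Q) : q = 0 := by
    rw [← hps q, hb (s q)]
    simp [hpb]
  rw [h0 q, h0 r]

end MonoidAlgebra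

open MulOpposite in
theorem MonoidAlgebra.exists_projective_augmentation_eq_zero {G : Type} [Group G] {H : Subgroup G}
    (hne : H ≠ ⊥) (hfg : H.FG) (hH : ⁅H, H⁆ = H) :
    ∃ (P : Type) (_ : AddCommGroup P) (_ : Module (MonoidAlgebra ℤ G)ᵐᵒᵖ P),
      Nontrivial P ∧ Module.Projective (MonoidAlgebra ℤ G)ᵐᵒᵖ P ∧
      ∀ (f : P →ₗ[(MonoidAlgebra ℤ G)ᵐᵒᵖ] (MonoidAlgebra ℤ G)ᵐᵒᵖ) (p : P),
        augmentation G (f p).unop = 0 := by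
  obtain ⟨n, s, b, ⟨i, hi⟩, hb⟩ := (of ℤ G).exists_sum_mul_sub_one_eq hfg hH hne
  have hx (l) : ∑ i, ∑ j, op (of ℤ G (s i) - 1) * op (of ℤ G (s j) - 1) * op (b l i j) =
      op (of ℤ G (s l) - 1) := by
    simp only [← op_mul, ← Finset.op_sum, hb]
  have hi' : op (of ℤ G (s i) - 1) ≠ 0 := by
    rw [Ne, op_eq_zero_iff, sub_eq_zero, ← map_one (of ℤ G)]
    exact fun h ↦ hi (of_injective h)
  obtain ⟨P, hP₁, hP₂, hP₃, hP₄, hP⟩ := exists_projective_of_sum_mul_eq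
    (augmentation G).op hx ⟨i, hi'⟩ fun i ↦ by simp
  exact ⟨P, hP₁, hP₂, hP₃, hP₄, fun f p ↦ op_injective (hP f p)⟩

/-- **Theorem** (Linnell–Puninski–Smith).  Let `G` be a polycyclic-by-finite
group which is not polycyclic.  Then there exists a nonzero projective right
`ℤG`-module `P` (formalized as a module over the opposite ring `(ℤG)ᵐᵒᵖ`) having
no nonzero finitely generated direct summands; in particular, `P` is not
free. -/
theorem exists_projective_no_fg_summand (G : Type) [Group G]
    (hG : IsPolycyclicByFinite G) (hnp : ¬ IsPolycyclic G) :
    ∃ P : ModuleCat (MonoidAlgebra ℤ G)ᵐᵒᵖ,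
      Nontrivial P ∧ Module.Projective (MonoidAlgebra ℤ G)ᵐᵒᵖ P ∧
      (∀ Q : Submodule (MonoidAlgebra ℤ G)ᵐᵒᵖ P,
        (∃ Q' : Submodule (MonoidAlgebra ℤ G)ᵐᵒᵖ P, IsCompl Q Q') →
        Module.Finite (MonoidAlgebra ℤ G)ᵐᵒᵖ Q → Q = ⊥) ∧
      ¬ Module.Free (MonoidAlgebra ℤ G)ᵐᵒᵖ P := by
  obtain ⟨H, hne, hfg, hH⟩ := hG.exists_perfect_subgroup hnp
  have := hG.residuallyFinite
  obtain ⟨P₀, _, _, _, _, hP₀⟩ :=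
    MonoidAlgebra.exists_projective_augmentation_eq_zero hne hfg hH
  let R := (MonoidAlgebra ℤ G)ᵐᵒᵖ
  let P := ULift.{u_1} P₀
  have hproj : Module.Projective R P := Module.Projective.of_equiv ULift.moduleEquiv.symm
  have hP (f : P →ₗ[R] R) (p : P) : MonoidAlgebra.augmentation G (f p).unop = 0 :=
    hP₀ (f ∘ₗ ULift.moduleEquiv.symm.toLinearMap) p.down
  refine ⟨ModuleCat.of R P, inferInstanceAs (Nontrivial P), hproj, ?_, fun hfree ↦ ?_⟩
  · rintro Q ⟨Q', hQ⟩ hfin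
    change Submodule R P at Q
    change Submodule R P at Q'
    have hQproj : Module.Projective R Q :=
      Module.Projective.of_split Q.subtype (Q.projectionOnto Q' hQ)
        (Submodule.projectionOnto_comp_subtype hQ)
    rw [← Submodule.subsingleton_iff_eq_bot]
    refine MonoidAlgebra.subsingleton_of_forall_augmentation_eq_zero (G := G) fun f q ↦ ?_
    have := hP (f ∘ₗ Q.projectionOnto Q' hQ) q
    rwa [LinearMap.comp_apply, Submodule.projectionOnto_apply_left] at this
  · change Module.Free R P at hfree
    let b := Module.Free.chooseBasis R P
    obtain ⟨i⟩ := b.index_nonempty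
    have := hP (b.coord i) (b i)
    simp at this
end

section
/- Let $G$ be a soluble-by-finite group which is not soluble. Then $G$ has a nonidentity perfect normal subgroup, i.e. a normal subgroup $H \neq \{e\}$ with $H = [H,H]$. -/
namespace Subgroup

variable {G : Type*} [Group G]

/-- The commutator of normal subgroups distributes over joins, in the first argument. -/
theorem commutator_sup_le_sup_commutator (H K L : Subgroup G) [H.Normal] [K.Normal] [L.Normal] :
    ⁅H ⊔ K, L⁆ ≤ ⁅H, L⁆ ⊔ ⁅K, L⁆ := by
  rw [commutator_le]
  intro g hg l hl
  obtain ⟨h, hh, k, hk, rfl⟩ := mem_sup_of_normal_right.mp hg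
  rw [commutatorElement_mul_left_eq_conj_mul]
  refine mul_mem ?_ (mem_sup_left (commutator_mem_commutator hh hl))
  exact mem_sup_right ((commutator_normal K L).conj_mem _ (commutator_mem_commutator hk hl) h)

/-- If a normal subgroup `D` is perfect modulo a normal subgroup `A`, then `⁅D, D⁆` is perfect
modulo `⁅A, A⁆`. -/
theorem commutator_le_commutator_commutator_sup {D A : Subgroup G} [D.Normal] [A.Normal]
    (h : D ≤ ⁅D, D⁆ ⊔ A) : ⁅D, D⁆ ≤ ⁅⁅D, D⁆, ⁅D, D⁆⁆ ⊔ ⁅A, A⁆ := by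
  have expand : ⁅D, D⁆ ≤ ⁅⁅D, D⁆, ⁅D, D⁆⁆ ⊔ ⁅⁅D, D⁆, A⁆ ⊔ ⁅A, A⁆ := by
    refine (commutator_mono h h).trans <|
      (commutator_sup_le_sup_commutator _ _ _).trans (sup_le ?_ ?_)
    · rw [commutator_comm]
      refine (commutator_sup_le_sup_commutator _ _ _).trans (sup_le ?_ ?_)
      · exact le_sup_left.trans le_sup_left
      · rw [commutator_comm]
        exact le_sup_right.trans le_sup_left
    · rw [commutator_comm]
      refine (commutator_sup_le_sup_commutator _ _ _).trans (sup_le ?_ ?_)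
      · exact le_sup_right.trans le_sup_left
      · exact le_sup_right
  have perfect_mod : ⁅D, D⁆ ≤ ⁅⁅D, D⁆, ⁅D, D⁆⁆ ⊔ A :=
    expand.trans <| sup_le (sup_le_sup_left (commutator_le_right _ _) _)
      (A.commutator_le_self.trans le_sup_right)
  refine expand.trans (sup_le (sup_le le_sup_left ?_) le_sup_right)
  refine (commutator_mono perfect_mod le_rfl).trans <|
    (commutator_sup_le_sup_commutator _ _ _).trans (sup_le_sup_right (commutator_le_left _ _) _)

end Subgroup

/-- The derived series of a group stabilizes modulo any normal subgroup of finite index. -/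
theorem exists_derivedSeries_le_sup_of_finiteIndex {G : Type*} [Group G] (N : Subgroup G)
    [N.Normal] [N.FiniteIndex] : ∃ k, derivedSeries G k ≤ derivedSeries G (k + 1) ⊔ N := by
  obtain ⟨k, hk⟩ := WellFoundedLT.antitone_chain_condition (derivedSeries_antitone (G ⧸ N))
  refine ⟨k, ?_⟩
  have hmap := (hk (k + 1) k.le_succ).le
  rw [← map_derivedSeries_eq (QuotientGroup.mk'_surjective N),
    ← map_derivedSeries_eq (QuotientGroup.mk'_surjective N), Subgroup.map_le_map_iff,
    QuotientGroup.ker_mk'] at hmap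
  exact hmap


/-- **Lemma** (Linnell–Puninski–Smith).  Let `G` be a soluble-by-finite group
which is not soluble.  Then `G` has a nonidentity perfect normal subgroup, i.e.
a normal subgroup `H ≠ {e}` with `H = [H, H]`. -/
theorem exists_perfect_normal_subgroup (G : Type*) [Group G]
    (hsbf : ∃ N : Subgroup G, N.Normal ∧ N.FiniteIndex ∧ IsSolvable N)
    (hns : ¬ IsSolvable G) :
    ∃ H : Subgroup G, H.Normal ∧ H ≠ ⊥ ∧ ⁅H, H⁆ = H := by
  obtain ⟨N, hN, hfin, hsol⟩ := hsbf
  have stable (d : ℕ) : ∃ k, derivedSeries G k ≤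
      derivedSeries G (k + 1) ⊔ (derivedSeries N d).map N.subtype := by
    induction d with
    | zero =>
      simpa [← MonoidHom.range_eq_map] using exists_derivedSeries_le_sup_of_finiteIndex N
    | succ d ih =>
      obtain ⟨k, hk⟩ := ih
      refine ⟨k + 1, ?_⟩
      rw [derivedSeries_succ N, Subgroup.map_commutator]
      exact Subgroup.commutator_le_commutator_commutator_sup hk
  obtain ⟨d, hd⟩ := hsol.solvable
  obtain ⟨k, hk⟩ := stable d
  rw [hd, Subgroup.map_bot, sup_bot_eq] at hk
  exact ⟨derivedSeries G k, inferInstance, fun h => hns ⟨⟨k, h⟩⟩,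
    le_antisymm (Subgroup.commutator_le_self _) hk⟩
end

section
/- Let $R$ be a right noetherian ring and let $P$ be a nonzero stably free right $R$-module, i.e. $P \oplus R^n \cong R^{n+m}$ for some natural number $n$ and some positive integer $m$. Then $P$ is a generator: the trace ideal of $P$ equals $R$, equivalently there exist $k$ and a surjective $R$-linear map $P^k \to R$. -/
/-- The trace ideal of a right `R`-module `P` (formalized as a module over the
opposite ring `Rᵐᵒᵖ`): the sum of the images of all right-linear maps `P → R`,
a right ideal of `R`, i.e. an `Rᵐᵒᵖ`-submodule of `R`. -/
def traceIdeal (R : Type*) [Ring R] (P : Type*) [AddCommGroup P]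
    [Module Rᵐᵒᵖ P] : Submodule Rᵐᵒᵖ R :=
  ⨆ f : P →ₗ[Rᵐᵒᵖ] R, LinearMap.range f

theorem apply_mem_traceIdeal {R P : Type*} [Ring R] [AddCommGroup P] [Module Rᵐᵒᵖ P]
    (f : P →ₗ[Rᵐᵒᵖ] R) (p : P) : f p ∈ traceIdeal R P :=
  Submodule.mem_iSup_of_mem f ⟨p, rfl⟩

/-- The trace ideal is also a left ideal. -/
theorem mul_mem_traceIdeal {R P : Type*} [Ring R] [AddCommGroup P] [Module Rᵐᵒᵖ P]
    (r : R) {t : R} (ht : t ∈ traceIdeal R P) : r * t ∈ traceIdeal R P := by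
  let mulLeft : R →ₗ[Rᵐᵒᵖ] R :=
    { toFun := fun x => r * x
      map_add' := mul_add r
      map_smul' := fun a x => by simp [MulOpposite.smul_eq_mul_unop, mul_assoc] }
  have h : traceIdeal R P ≤ (traceIdeal R P).comap mulLeft :=
    iSup_le fun f => by
      rintro _ ⟨p, rfl⟩
      exact apply_mem_traceIdeal (mulLeft ∘ₗ f) p
  exact h ht

/-- A right-linear map between finite free modules preserves the vectors with entries in a
two-sided ideal. -/
theorem apply_mem_of_forall_mem {R : Type*} [Ring R] {ι κ : Type*} [Fintype ι]
    {T : Submodule Rᵐᵒᵖ R} (hT : ∀ (r : R) {t : R}, t ∈ T → r * t ∈ T)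
    (A : (ι → R) →ₗ[Rᵐᵒᵖ] (κ → R)) {v : ι → R} (hv : ∀ i, v i ∈ T) (j : κ) :
    A v j ∈ T := by
  classical
  have h : v = ∑ i, MulOpposite.op (v i) • (Pi.single i 1 : ι → R) := by
    ext j
    simp [Finset.sum_apply, Pi.single_apply]
  rw [h, map_sum, Finset.sum_apply]
  refine Submodule.sum_mem _ fun i _ => ?_
  rw [map_smul, Pi.smul_apply, MulOpposite.smul_eq_mul_unop]
  exact hT _ (hv i)

/-- Over a right noetherian ring, a two-sided ideal modulo which a map from a finite free module
to one of larger rank is surjective is the unit ideal. -/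
theorem eq_top_of_forall_exists_sub_mem {R : Type*} [Ring R] [IsNoetherianRing Rᵐᵒᵖ]
    {T : Submodule Rᵐᵒᵖ R} (hT : ∀ (r : R) {t : R}, t ∈ T → r * t ∈ T)
    {n m : ℕ} (hm : 0 < m) (A : (Fin n → R) →ₗ[Rᵐᵒᵖ] (Fin (n + m) → R))
    (hA : ∀ w : Fin (n + m) → R, ∃ v, ∀ i, A v i - w i ∈ T) : T = ⊤ := by
  have : IsNoetherian Rᵐᵒᵖ R :=
    isNoetherian_of_linearEquiv (MulOpposite.opLinearEquiv Rᵐᵒᵖ : R ≃ₗ[Rᵐᵒᵖ] Rᵐᵒᵖ).symm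
  let N : Submodule Rᵐᵒᵖ (Fin n → R) := Submodule.pi Set.univ fun _ => T
  let C : (Fin n → R) →ₗ[Rᵐᵒᵖ] (Fin n → R) :=
    LinearMap.funLeft Rᵐᵒᵖ R (Fin.castAdd m) ∘ₗ A
  have hC : N ≤ N.comap C := fun v hv i _ =>
    apply_mem_of_forall_mem hT A (fun i => hv i trivial) (Fin.castAdd m i)
  have hsurj : Function.Surjective (N.mapQ N C hC) := by
    intro x
    obtain ⟨w, rfl⟩ := N.mkQ_surjective x
    obtain ⟨v, hv⟩ := hA (Fin.append w 0)
    refine ⟨N.mkQ v, ?_⟩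
    rw [Submodule.mkQ_apply, Submodule.mapQ_apply, Submodule.mkQ_apply, Submodule.Quotient.eq]
    intro i _
    simpa [C, LinearMap.funLeft_apply] using hv (Fin.castAdd m i)
  have hinj := IsNoetherian.injective_of_surjective_endomorphism _ hsurj
  obtain ⟨v, hv⟩ := hA (Fin.append 0 1)
  have hvN : v ∈ N := by
    rw [← Submodule.Quotient.mk_eq_zero]
    apply hinj
    rw [Submodule.mapQ_apply, map_zero, Submodule.Quotient.mk_eq_zero]
    intro i _
    simpa [C, LinearMap.funLeft_apply] using hv (Fin.castAdd m i)
  have h1 : (1 : R) ∈ T := by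
    have h := Submodule.sub_mem _
      (apply_mem_of_forall_mem hT A (fun i => hvN i trivial) (Fin.natAdd n ⟨0, hm⟩))
      (hv (Fin.natAdd n ⟨0, hm⟩))
    rwa [sub_sub_cancel, Fin.append_right] at h
  exact eq_top_iff.2 fun r _ => by simpa using hT r h1

theorem exists_surjective_of_traceIdeal_eq_top {R P : Type*} [Ring R] [AddCommGroup P]
    [Module Rᵐᵒᵖ P] (h : traceIdeal R P = ⊤) :
    ∃ (k : ℕ) (g : (Fin k → P) →ₗ[Rᵐᵒᵖ] R), Function.Surjective g := by
  have h1 : (1 : R) ∈ ⨆ f : P →ₗ[Rᵐᵒᵖ] R, LinearMap.range f := by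
    change (1 : R) ∈ traceIdeal R P
    rw [h]
    trivial
  obtain ⟨x, hx, hsum⟩ := (Submodule.mem_iSup_iff_exists_finsupp _ _).1 h1
  choose p hp using hx
  let e := x.support.equivFin
  let g : (Fin x.support.card → P) →ₗ[Rᵐᵒᵖ] R :=
    ∑ i, (e.symm i).1 ∘ₗ LinearMap.proj i
  have hg : g (fun i => p (e.symm i).1) = 1 := by
    simp only [g, LinearMap.sum_apply, LinearMap.comp_apply, LinearMap.proj_apply, hp]
    rw [e.symm.sum_comp fun f : x.support => x f.1, ← hsum, Finsupp.sum,
      Finset.sum_coe_sort x.support fun f => x f]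
  refine ⟨_, g, fun r => ⟨MulOpposite.op r • fun i => p (e.symm i).1, ?_⟩⟩
  rw [map_smul, hg]
  simp

/-- Every nonzero stably free right module over a right noetherian ring is a
generator: its trace ideal is all of `R`; equivalently, some finite power of it
admits a surjective right-linear map onto `R`.  (Right `R`-modules are
formalized as modules over the opposite ring `Rᵐᵒᵖ`, and `R` is right
noetherian iff `Rᵐᵒᵖ` is left noetherian.) -/
theorem stablyFree_is_generator (R : Type*) [Ring R]
    [IsNoetherianRing Rᵐᵒᵖ] (P : Type*) [AddCommGroup P] [Module Rᵐᵒᵖ P]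
    (hnz : Nontrivial P)
    (hsf : ∃ (n m : ℕ), 0 < m ∧
      Nonempty ((P × (Fin n → R)) ≃ₗ[Rᵐᵒᵖ] (Fin (n + m) → R))) :
    traceIdeal R P = ⊤ ∧
    ∃ (k : ℕ) (g : (Fin k → P) →ₗ[Rᵐᵒᵖ] R), Function.Surjective g := by
  obtain ⟨n, m, hm, ⟨e⟩⟩ := hsf
  have h : traceIdeal R P = ⊤ := by
    refine eq_top_of_forall_exists_sub_mem mul_mem_traceIdeal hm
      (e.toLinearMap ∘ₗ LinearMap.inr Rᵐᵒᵖ P (Fin n → R)) fun w => ⟨(e.symm w).2, fun i => ?_⟩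
    have hw : e (0, (e.symm w).2) - w = e (-(e.symm w).1, 0) := by
      apply e.symm.injective
      rw [map_sub, e.symm_apply_apply, e.symm_apply_apply]
      ext1 <;> simp
    have := apply_mem_traceIdeal
      (LinearMap.proj i ∘ₗ e.toLinearMap ∘ₗ LinearMap.inl Rᵐᵒᵖ P (Fin n → R)) (-(e.symm w).1)
    simpa [← hw] using this
  exact ⟨h, exists_surjective_of_traceIdeal_eq_top h⟩
end
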